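/- arXiv:2603.27774 — 2 statements merged into one kernel-verified Lean document; each statement's English description precedes it below -/
import Mathlib

section
/- For every real ε > 0 there exists N such that for every n ≥ N and every monotone 2-CNF formula φ with at most n variables, there exists a 2-CNF formula φ' such that φ ⊢* φ' and |φ'| ≤ (1/4 + ε) · n² / log₂ n. -/
namespace BVAPaper

/-- A literal is a propositional variable (a natural number) together with a
polarity: `true` for a positive literal, `false` for a negative one. -/
abbrev Lit := ℕ × Bool

/-- A clause is a finite set of literals (required to be pairwise
non-complementary via `IsClause`). -/
abbrev Clause := Finset Lit

/-- A formula is a finite set of clauses; its size is its number of clauses. -/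
abbrev Formula := Finset Clause

/-- A genuine clause: it contains no pair of complementary literals. -/
def IsClause (C : Clause) : Prop := ∀ v : ℕ, ¬ ((v, true) ∈ C ∧ (v, false) ∈ C)

/-- A 2-CNF formula: every member is a genuine clause with exactly two literals. -/
def Is2CNF (φ : Formula) : Prop := ∀ C ∈ φ, IsClause C ∧ C.card = 2

/-- The set of variables occurring in a formula. -/
def Vars (φ : Formula) : Finset ℕ := φ.biUnion (fun C => C.image Prod.fst)

/-- A literal is true under an assignment. -/
def LitTrue (τ : ℕ → Bool) (l : Lit) : Prop := τ l.1 = l.2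

/-- An assignment satisfies a formula if it makes some literal of every clause true. -/
def Satisfies (τ : ℕ → Bool) (φ : Formula) : Prop := ∀ C ∈ φ, ∃ l ∈ C, LitTrue τ l

/-- `φ` semantically implies the equivalence of the literals `l₁` and `l₂`. -/
def ImpliesEquiv (φ : Formula) (l₁ l₂ : Lit) : Prop :=
  ∀ τ : ℕ → Bool, Satisfies τ φ → (LitTrue τ l₁ ↔ LitTrue τ l₂)

/-- A simple 2-CNF formula: (a) no two distinct literals are implied equivalent,
(b) every clause contains a negative literal, (c) no two distinct clauses are over
the same pair of variables. -/
def IsSimple (φ : Formula) : Prop :=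
  (∀ l₁ l₂ : Lit, l₁ ≠ l₂ → ¬ ImpliesEquiv φ l₁ l₂) ∧
  (∀ C ∈ φ, ∃ l ∈ C, l.2 = false) ∧
  (∀ C₁ ∈ φ, ∀ C₂ ∈ φ, C₁.image Prod.fst = C₂.image Prod.fst → C₁ = C₂)

/-- A monotone formula: every literal occurring in it is positive. -/
def MonotoneFormula (φ : Formula) : Prop := ∀ C ∈ φ, ∀ l ∈ C, l.2 = true

/-- `𝒞 ⋈ 𝒟`: the set of clauses `C ∪ D` for `C ∈ 𝒞` and `D ∈ 𝒟`. -/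
def JoinClauses (𝒞 𝒟 : Finset Clause) : Finset Clause :=
  (𝒞 ×ˢ 𝒟).image (fun p => p.1 ∪ p.2)

/-- One BVA step. -/
def BVAStep (φ φ' : Formula) : Prop :=
  ∃ (𝒞 𝒟 : Finset Clause) (y : ℕ),
    (∀ C ∈ 𝒞, IsClause C ∧ C.Nonempty) ∧
    (∀ D ∈ 𝒟, IsClause D ∧ D.Nonempty) ∧
    JoinClauses 𝒞 𝒟 ⊆ φ ∧
    y ∉ Vars φ ∧
    φ' = (φ \ JoinClauses 𝒞 𝒟)
      ∪ 𝒞.image (fun C => insert ((y, true) : Lit) C)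
      ∪ 𝒟.image (fun D => insert ((y, false) : Lit) D)

/-- Idealized BVA: the reflexive transitive closure of single BVA steps. -/
def BVAChain : Formula → Formula → Prop := Relation.ReflTransGen BVAStep

/-- Negate the variables from `S` inside a literal. -/
def flipLit (S : Finset ℕ) (l : Lit) : Lit := if l.1 ∈ S then (l.1, !l.2) else l

/-- Negate the variables from `S` throughout a formula. -/
def flipFormula (S : Finset ℕ) (φ : Formula) : Formula :=
  φ.image (fun C => C.image (flipLit S))

/-- `φ ≅_W φ'`: `φ'` is obtained from `φ` by replacing some variables from `W`
by their negations wherever they appear. -/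
def EquivW (W : Finset ℕ) (φ φ' : Formula) : Prop :=
  ∃ S ⊆ W, φ' = flipFormula S φ

/-- `φ'` encodes `φ` over the base variables `X`: for every assignment `τ` of `X`,
`τ` satisfies `φ` iff `τ` extends to a satisfying assignment of `φ'`. -/
def Encodes (φ' φ : Formula) (X : Finset ℕ) : Prop :=
  ∀ τ : ℕ → Bool,
    Satisfies τ φ ↔ ∃ σ : ℕ → Bool, (∀ x ∈ X, σ x = τ x) ∧ Satisfies σ φ'

/-- The direct encoding of the at-most-one constraint on the variables `0, …, n-1`. -/
def atMostOne (n : ℕ) : Formula :=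
  (((Finset.range n) ×ˢ (Finset.range n)).filter (fun p => p.1 < p.2)).image
    (fun p => ({(p.1, false), (p.2, false)} : Clause))

/-- A diagram: a graph with both undirected edges (represented as a symmetric
set of ordered pairs) and directed edges. -/
structure Diagram where
  verts : Finset ℕ
  undir : Finset (ℕ × ℕ)
  dir : Finset (ℕ × ℕ)

/-- Well-formedness of a diagram: no loops, edges between vertices, the
undirected edge set is symmetric, and at most one edge between any two vertices. -/
def Diagram.WF (G : Diagram) : Prop :=
  (∀ e ∈ G.undir, e.1 ∈ G.verts ∧ e.2 ∈ G.verts ∧ e.1 ≠ e.2) ∧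
  (∀ e ∈ G.dir, e.1 ∈ G.verts ∧ e.2 ∈ G.verts ∧ e.1 ≠ e.2) ∧
  (∀ u v : ℕ, (u, v) ∈ G.undir → (v, u) ∈ G.undir) ∧
  (∀ u v : ℕ, (u, v) ∈ G.undir → (u, v) ∉ G.dir ∧ (v, u) ∉ G.dir) ∧
  (∀ u v : ℕ, (u, v) ∈ G.dir → (v, u) ∉ G.dir)

/-- The complete diagram `K_n` on vertices `0, …, n-1`: all edges undirected. -/
def completeDiagram (n : ℕ) : Diagram where
  verts := Finset.range n
  undir := ((Finset.range n) ×ˢ (Finset.range n)).filter (fun p => p.1 ≠ p.2)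
  dir := ∅

/-- The diagram associated to a simple 2-CNF formula: an undirected edge
`{x, y}` for each clause `(¬x ∨ ¬y)` and a directed edge `(x, y)` for each
clause `(¬x ∨ y)`. -/
def diagramOf (φ : Formula) : Diagram where
  verts := Vars φ
  undir := ((Vars φ) ×ˢ (Vars φ)).filter
    (fun p => ({(p.1, false), (p.2, false)} : Clause) ∈ φ)
  dir := ((Vars φ) ×ˢ (Vars φ)).filter
    (fun p => ({(p.1, false), (p.2, true)} : Clause) ∈ φ)

/-- A polarized diagram: a directed graph with a polarity on its edges
(`true` = `+`, `false` = `−`). -/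
structure PolDiagram where
  verts : Finset ℕ
  edges : Finset (ℕ × ℕ)
  pol : ℕ × ℕ → Bool

/-- `(P, P.pol)` is a polarized diagram of the diagram `G`: every undirected
edge of `G` is oriented (in exactly one way) with polarity `−`, and every
directed edge of `G` is kept with polarity `+`. -/
def IsPolarizationOf (P : PolDiagram) (G : Diagram) : Prop :=
  P.verts = G.verts ∧
  (∀ u v : ℕ, (u, v) ∈ G.dir ↔ ((u, v) ∈ P.edges ∧ P.pol (u, v) = true)) ∧
  (∀ u v : ℕ, (u, v) ∈ G.undir ↔
    (((u, v) ∈ P.edges ∧ P.pol (u, v) = false) ∨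
     ((v, u) ∈ P.edges ∧ P.pol (v, u) = false))) ∧
  (∀ u v : ℕ, ¬ ((u, v) ∈ P.edges ∧ (v, u) ∈ P.edges))

/-- A polarized rectifier network: base vertices, auxiliary vertices, directed
edges, and a polarity function (only meaningful on edges into base vertices). -/
structure PRN where
  base : Finset ℕ
  aux : Finset ℕ
  edges : Finset (ℕ × ℕ)
  pol : ℕ × ℕ → Bool

/-- Well-formedness of a PRN: base and auxiliary vertices are disjoint, and
edges are loopless edges between vertices. -/
def PRN.WF (R : PRN) : Prop :=
  Disjoint R.base R.aux ∧
  (∀ e ∈ R.edges, e.1 ∈ R.base ∪ R.aux ∧ e.2 ∈ R.base ∪ R.aux ∧ e.1 ≠ e.2)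

/-- A valid walk from the base vertex `u` to the base vertex `v`: a sequence of
length ≥ 2 of consecutive edges whose interior vertices are auxiliary. -/
def ValidWalk (R : PRN) (u v : ℕ) (π : List ℕ) : Prop :=
  2 ≤ π.length ∧
  π.head? = some u ∧ π.getLast? = some v ∧
  u ∈ R.base ∧ v ∈ R.base ∧
  List.Chain' (fun a b => (a, b) ∈ R.edges) π ∧
  (∀ i : ℕ, 0 < i → i + 1 < π.length → π.getD i 0 ∈ R.aux)

/-- The polarity of a walk: the polarity of its last edge. -/
def walkPol (R : PRN) (π : List ℕ) : Bool :=
  R.pol (π.getD (π.length - 2) 0, π.getD (π.length - 1) 0)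

/-- A strict polarized rectifier network: (1) for distinct base vertices `u, v`
there is at most one valid walk from `u` to `v` or from `v` to `u` in total, and
(2) every auxiliary vertex belongs to some valid walk. -/
def IsSPRN (R : PRN) : Prop :=
  (∀ u ∈ R.base, ∀ v ∈ R.base, u ≠ v →
    ∀ π₁ π₂ : List ℕ,
      (ValidWalk R u v π₁ ∨ ValidWalk R v u π₁) →
      (ValidWalk R u v π₂ ∨ ValidWalk R v u π₂) → π₁ = π₂) ∧
  (∀ a ∈ R.aux, ∃ u v : ℕ, ∃ π : List ℕ, ValidWalk R u v π ∧ a ∈ π)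

/-- The PRN `R` realizes the polarized diagram `P`. -/
def RealizesPol (R : PRN) (P : PolDiagram) : Prop :=
  R.base = P.verts ∧
  ∀ u ∈ P.verts, ∀ v ∈ P.verts,
    ((u, v) ∈ P.edges ↔ ∃ π : List ℕ, ValidWalk R u v π ∧ walkPol R π = P.pol (u, v))

/-- The PRN `R` realizes the diagram `G`: it realizes some polarized diagram of `G`. -/
def RealizesDiagram (R : PRN) (G : Diagram) : Prop :=
  ∃ P : PolDiagram, IsPolarizationOf P G ∧ RealizesPol R P

/-- The 2-CNF formula `F_R` associated to a PRN `R`. -/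
def PRN.formula (R : PRN) : Formula :=
  R.edges.image (fun e =>
    if e.2 ∈ R.base ∧ R.pol e = false
    then ({(e.1, false), (e.2, false)} : Clause)
    else ({(e.1, false), (e.2, true)} : Clause))

/-- The PRN associated to a polarized diagram (no auxiliary vertices). -/
def prnOfPol (P : PolDiagram) : PRN :=
  ⟨P.verts, ∅, P.edges, P.pol⟩

/-- A coherent biclique `(X, Y)` of a PRN. -/
def CoherentBiclique (R : PRN) (X Y : Finset ℕ) : Prop :=
  X.Nonempty ∧ Y.Nonempty ∧ Disjoint X Y ∧
  X ⊆ R.base ∪ R.aux ∧ Y ⊆ R.base ∪ R.aux ∧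
  (∀ x ∈ X, ∀ y ∈ Y, (x, y) ∈ R.edges) ∧
  (∀ y ∈ Y, y ∈ R.base → ∀ x₁ ∈ X, ∀ x₂ ∈ X, R.pol (x₁, y) = R.pol (x₂, y))

/-- `R'` is the biclique reduction of `R` with respect to some coherent biclique. -/
def BicliqueStep (R R' : PRN) : Prop :=
  ∃ (X Y : Finset ℕ) (z : ℕ),
    CoherentBiclique R X Y ∧
    z ∉ R.base ∪ R.aux ∧
    R'.base = R.base ∧
    R'.aux = insert z R.aux ∧
    R'.edges = (R.edges \ (X ×ˢ Y)) ∪ (X ×ˢ ({z} : Finset ℕ)) ∪ (({z} : Finset ℕ) ×ˢ Y) ∧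
    (∀ y ∈ Y, y ∈ R.base → ∀ x ∈ X, R'.pol (z, y) = R.pol (x, y)) ∧
    (∀ e ∈ R.edges \ (X ×ˢ Y), e.2 ∈ R.base → R'.pol e = R.pol e)

/-- `R ↪* R'`: the reflexive transitive closure of biclique reduction. -/
def BicliqueChain : PRN → PRN → Prop := Relation.ReflTransGen BicliqueStep

/-- The total degree (in-degree plus out-degree) of a vertex in a PRN. -/
def totalDeg (R : PRN) (v : ℕ) : ℕ :=
  (R.edges.filter (fun e => e.1 = v)).card + (R.edges.filter (fun e => e.2 = v)).card

/-- All clauses consisting of one literal from `X` and one literal from `Y`. -/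
def pairClauses (X Y : Finset Lit) : Formula :=
  (X ×ˢ Y).image (fun p => ({p.1, p.2} : Clause))

theorem mem_pairClauses {X Y : Finset Lit} {C : Clause} :
    C ∈ pairClauses X Y ↔ ∃ x ∈ X, ∃ y ∈ Y, C = {x, y} := by
  simp only [pairClauses, Finset.mem_image, Finset.mem_product]
  constructor
  · rintro ⟨⟨a, b⟩, ⟨ha, hb⟩, rfl⟩; exact ⟨a, ha, b, hb, rfl⟩
  · rintro ⟨a, ha, b, hb, rfl⟩; exact ⟨(a, b), ⟨ha, hb⟩, rfl⟩

theorem mem_Vars {φ : Formula} {v : ℕ} : v ∈ Vars φ ↔ ∃ C ∈ φ, ∃ l ∈ C, l.1 = v := by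
  simp [Vars]

theorem isClause_pair_and_card {a b : Lit} (h : a.1 ≠ b.1) :
    IsClause {a, b} ∧ ({a, b} : Clause).card = 2 := by
  refine ⟨fun v hv => ?_, Finset.card_pair fun e => h (by rw [e])⟩
  simp only [Finset.mem_insert, Finset.mem_singleton] at hv
  obtain ⟨h1 | h1, h2 | h2⟩ := hv <;> simp_all [Prod.ext_iff]

/-- The result of replacing all the bicliques `X i × Y i`, `i ∈ s`, through the new
variables `z i`. -/
def bicliqueReplace {ι : Type*} (φ : Formula) (s : Finset ι) (z : ι → ℕ)
    (X Y : ι → Finset Lit) : Formula :=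
  (φ \ s.biUnion fun i => pairClauses (X i) (Y i))
    ∪ s.biUnion (fun i => pairClauses {((z i, true) : Lit)} (X i))
    ∪ s.biUnion (fun i => pairClauses {((z i, false) : Lit)} (Y i))

theorem mem_bicliqueReplace {ι : Type*} {φ : Formula} {s : Finset ι} {z : ι → ℕ}
    {X Y : ι → Finset Lit} {C : Clause} :
    C ∈ bicliqueReplace φ s z X Y ↔
      (C ∈ φ ∧ ∀ i ∈ s, C ∉ pairClauses (X i) (Y i)) ∨
      (∃ i ∈ s, ∃ x ∈ X i, C = {(z i, true), x}) ∨
      (∃ i ∈ s, ∃ y ∈ Y i, C = {(z i, false), y}) := by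
  simp only [bicliqueReplace, Finset.mem_union, Finset.mem_sdiff, Finset.mem_biUnion,
    mem_pairClauses, Finset.mem_singleton, exists_eq_left, or_assoc, not_exists, not_and]

/-- Edge-disjoint bicliques can be replaced one after the other by BVA steps. -/
theorem bvaChain_bicliqueReplace {ι : Type*} (φ : Formula) (s : Finset ι) (z : ι → ℕ)
    (X Y : ι → Finset Lit) (hz : Set.InjOn z s) (hfresh : ∀ i ∈ s, z i ∉ Vars φ)
    (hX : ∀ i ∈ s, ∀ x ∈ X i, ∀ j ∈ s, x.1 ≠ z j)
    (hY : ∀ i ∈ s, ∀ y ∈ Y i, ∀ j ∈ s, y.1 ≠ z j)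
    (hsub : ∀ i ∈ s, pairClauses (X i) (Y i) ⊆ φ)
    (hdisj : ∀ i ∈ s, ∀ j ∈ s, ∀ C ∈ pairClauses (X i) (Y i),
      C ∈ pairClauses (X j) (Y j) → i = j) :
    BVAChain φ (bicliqueReplace φ s z X Y) := by
  classical
  induction s using Finset.induction_on with
  | empty =>
    have : bicliqueReplace φ (∅ : Finset ι) z X Y = φ := by simp [bicliqueReplace]
    rw [this]; exact Relation.ReflTransGen.refl
  | insert i s hi ih =>
    have hs : ∀ {j}, j ∈ s → j ∈ insert i s := fun h => Finset.mem_insert_of_mem h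
    have hii : i ∈ insert i s := Finset.mem_insert_self i s
    have hne : ∀ j ∈ s, z i ≠ z j := fun j hj e => hi (by
      have := hz (by exact_mod_cast hii) (by exact_mod_cast hs hj) e
      rwa [this])
    refine Relation.ReflTransGen.tail (ih (hz.mono (by simp)) (fun j hj => hfresh j (hs hj))
      (fun j hj x hx k hk => hX j (hs hj) x hx k (hs hk))
      (fun j hj x hx k hk => hY j (hs hj) x hx k (hs hk))
      (fun j hj => hsub j (hs hj)) (fun j hj k hk => hdisj j (hs hj) k (hs hk))) ?_
    have hjoin : JoinClauses ((X i).image fun x => ({x} : Clause))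
        ((Y i).image fun y => ({y} : Clause)) = pairClauses (X i) (Y i) := by
      ext C
      simp only [JoinClauses, mem_pairClauses, Finset.mem_image, Finset.mem_product]
      constructor
      · rintro ⟨⟨_, _⟩, ⟨⟨x, hx, rfl⟩, y, hy, rfl⟩, rfl⟩
        exact ⟨x, hx, y, hy, rfl⟩
      · rintro ⟨x, hx, y, hy, rfl⟩
        exact ⟨({x}, {y}), ⟨⟨x, hx, rfl⟩, y, hy, rfl⟩, rfl⟩
    have hsing : ∀ l : Lit, IsClause {l} := fun l v hv => by
      have h1 := Finset.mem_singleton.1 hv.1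
      have h2 := Finset.mem_singleton.1 hv.2
      simp [← h1] at h2
    have hnot : ∀ j ∈ s, ∀ b : Bool, ∀ l : Lit, ({(z j, b), l} : Clause) ∉ φ :=
      fun j hj b l h => hfresh j (hs hj) (mem_Vars.2 ⟨_, h, (z j, b), by simp, rfl⟩)
    refine ⟨(X i).image fun x => {x}, (Y i).image fun y => {y}, z i, ?_, ?_, ?_, ?_, ?_⟩
    · intro C hC
      obtain ⟨x, -, rfl⟩ := Finset.mem_image.1 hC
      exact ⟨hsing x, by simp⟩
    · intro C hC
      obtain ⟨x, -, rfl⟩ := Finset.mem_image.1 hC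
      exact ⟨hsing x, by simp⟩
    · rw [hjoin]
      intro C hC
      refine mem_bicliqueReplace.2 (Or.inl ⟨hsub i hii hC, fun j hj hCj => ?_⟩)
      exact hi (hdisj i hii j (hs hj) C hC hCj ▸ hj)
    · intro hv
      obtain ⟨C, hC, l, hl, hlz⟩ := mem_Vars.1 hv
      rcases mem_bicliqueReplace.1 hC with ⟨h, -⟩ | ⟨j, hj, x, hx, rfl⟩ | ⟨j, hj, x, hx, rfl⟩
      · exact hfresh i hii (mem_Vars.2 ⟨C, h, l, hl, hlz⟩)
      · rcases Finset.mem_insert.1 hl with rfl | hl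
        · exact hne j hj hlz.symm
        · rw [Finset.mem_singleton.1 hl] at hlz
          exact hX j (hs hj) x hx i hii hlz
      · rcases Finset.mem_insert.1 hl with rfl | hl
        · exact hne j hj hlz.symm
        · rw [Finset.mem_singleton.1 hl] at hlz
          exact hY j (hs hj) x hx i hii hlz
    · rw [hjoin]
      ext C
      have hold : (∃ j ∈ s, ∃ x ∈ X j, C = {(z j, true), x}) ∨
          (∃ j ∈ s, ∃ y ∈ Y j, C = {(z j, false), y}) → C ∉ pairClauses (X i) (Y i) := by
        rintro (⟨j, hj, x, -, rfl⟩ | ⟨j, hj, x, -, rfl⟩) h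
        · exact hnot j hj _ _ (hsub i hii h)
        · exact hnot j hj _ _ (hsub i hii h)
      have himage : ∀ (l : Lit) (Z : Finset Lit),
          C ∈ (Z.image fun x => ({x} : Clause)).image (fun C => insert l C) ↔
            ∃ x ∈ Z, C = {l, x} := fun l Z => by
        rw [Finset.image_image, Finset.mem_image]
        simp only [Function.comp_apply, eq_comm]
      rw [Finset.mem_union, Finset.mem_union, Finset.mem_sdiff, himage, himage,
        mem_bicliqueReplace, mem_bicliqueReplace]
      simp only [Finset.exists_mem_insert, Finset.forall_mem_insert]
      generalize (∃ j ∈ s, ∃ x ∈ X j, C = {(z j, true), x}) = p₁ at *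
      generalize (∃ j ∈ s, ∃ y ∈ Y j, C = {(z j, false), y}) = p₂ at *
      generalize (∃ x ∈ X i, C = {(z i, true), x}) = p₃
      generalize (∃ y ∈ Y i, C = {(z i, false), y}) = p₄
      generalize (∀ j ∈ s, C ∉ pairClauses (X j) (Y j)) = p₅
      generalize (C ∈ pairClauses (X i) (Y i)) = p₆ at *
      clear hz hfresh hX hY hsub hdisj ih
      tauto

/-- A finite set splits into sets of size at most two on which `κ` is constant, with at most one
set of size less than two for every value of `κ`. -/
theorem exists_pairing (κ : ℕ → ℕ) (B : ℕ) (T : Finset ℕ) (hB : ∀ x ∈ T, κ x < B) :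
    ∃ 𝒬 : Finset (Finset ℕ),
      (∀ Q ∈ 𝒬, Q ⊆ T ∧ Q.card ≤ 2 ∧ ∀ x ∈ Q, ∀ y ∈ Q, κ x = κ y) ∧
      (∀ x ∈ T, ∃ Q ∈ 𝒬, x ∈ Q) ∧
      (∀ Q ∈ 𝒬, ∀ Q' ∈ 𝒬, ∀ x ∈ Q, x ∈ Q' → Q = Q') ∧
      2 * 𝒬.card ≤ T.card + B := by
  let F : ℕ → Finset ℕ := fun b => T.filter fun x => κ x = b
  have hF : ∀ b, (F b).card % 2 * 1 + (F b).card / 2 * (1 + 1) = (F b).card := fun b => by omega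
  let P : ∀ b, Finpartition (F b) := fun b => (⊥ : Finpartition (F b)).equitabilise (hF b)
  have hle : ∀ b, ∀ Q ∈ (P b).parts, ∀ x ∈ Q, x ∈ T ∧ κ x = b := fun b Q hQ x hx => by
    have := (P b).le hQ hx
    exact Finset.mem_filter.1 this
  refine ⟨(Finset.range B).biUnion fun b => (P b).parts, ?_, ?_, ?_, ?_⟩
  · intro Q hQ
    obtain ⟨b, -, hQ⟩ := Finset.mem_biUnion.1 hQ
    refine ⟨fun x hx => (hle b Q hQ x hx).1, ?_, fun x hx y hy => ?_⟩
    · rcases Finpartition.card_eq_of_mem_parts_equitabilise hQ with h | h <;> omega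
    · rw [(hle b Q hQ x hx).2, (hle b Q hQ y hy).2]
  · intro x hx
    obtain ⟨Q, hQ, hxQ⟩ := (P (κ x)).exists_mem (show x ∈ F (κ x) by simp [F, hx])
    exact ⟨Q, Finset.mem_biUnion.2 ⟨κ x, by simpa using hB x hx, hQ⟩, hxQ⟩
  · intro Q hQ Q' hQ' x hx hx'
    obtain ⟨b, -, hQ⟩ := Finset.mem_biUnion.1 hQ
    obtain ⟨b', -, hQ'⟩ := Finset.mem_biUnion.1 hQ'
    obtain rfl : b = b' := by rw [← (hle b Q hQ x hx).2, ← (hle b' Q' hQ' x hx').2]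
    by_contra hne
    exact Finset.disjoint_left.1 ((P b).disjoint hQ hQ' hne) hx hx'
  · have h1 : ((Finset.range B).biUnion fun b => (P b).parts).card
        ≤ ∑ b ∈ Finset.range B, (P b).parts.card := Finset.card_biUnion_le
    have h2 : T.card = ∑ b ∈ Finset.range B, (F b).card :=
      Finset.card_eq_sum_card_fiberwise fun x hx => by simpa using hB x hx
    have h3 : 2 * ∑ b ∈ Finset.range B, (P b).parts.card
        ≤ ∑ b ∈ Finset.range B, ((F b).card + 1) := by
      rw [Finset.mul_sum]
      refine Finset.sum_le_sum fun b _ => ?_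
      have := Finpartition.card_parts_equitabilise (P := (⊥ : Finpartition (F b))) (hF b)
        one_ne_zero
      change 2 * ((⊥ : Finpartition (F b)).equitabilise (hF b)).parts.card ≤ _
      omega
    rw [Finset.sum_add_distrib, ← h2] at h3
    simp at h3
    omega

/-- An injection into `[0, n)` sends at most `k` elements to each interval `[g k, g k + k)`. -/
theorem card_filter_div_eq_le {V : Finset ℕ} {f : ℕ → ℕ} (hf : Set.InjOn f V) {k : ℕ}
    (hk : 0 < k) (g : ℕ) : (V.filter fun i => f i / k = g).card ≤ k := by
  have : (V.filter fun i => f i / k = g).card ≤ (Finset.Ico (g * k) (g * k + k)).card := by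
    refine Finset.card_le_card_of_injOn f ?_ (hf.mono (Finset.filter_subset _ _))
    intro i hi
    have hi := (Finset.mem_filter.1 hi).2
    simp only [Finset.coe_Ico, Set.mem_Ico]
    have h1 := Nat.div_mul_le_self (f i) k
    have h2 := Nat.lt_div_mul_add hk (a := f i)
    rw [hi] at h1 h2
    exact ⟨h1, h2⟩
  simpa using this

theorem card_filter_div_eq_div_le {V : Finset ℕ} {f : ℕ → ℕ} (hf : Set.InjOn f V) {k n : ℕ}
    (hk : 0 < k) (hn : V.card ≤ n) :
    ((V ×ˢ V).filter fun p => f p.1 / k = f p.2 / k).card ≤ n * k := by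
  have h := Finset.card_eq_sum_card_fiberwise
    (s := (V ×ˢ V).filter fun p => f p.1 / k = f p.2 / k) (t := V) (f := Prod.fst)
    (fun p hp => (Finset.mem_product.1 (Finset.mem_filter.1 hp).1).1)
  rw [h]
  refine (Finset.sum_le_card_nsmul V _ k fun i _ => ?_).trans (by
    rw [smul_eq_mul]; exact Nat.mul_le_mul_right k hn)
  refine le_trans (Finset.card_le_card_of_injOn Prod.snd ?_ ?_)
    (card_filter_div_eq_le hf hk (f i / k))
  · rintro ⟨a, b⟩ hp
    simp only [Finset.coe_filter, Set.mem_ofPred_eq, Finset.mem_filter, Finset.mem_product] at hp ⊢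
    obtain ⟨⟨⟨-, hb⟩, e⟩, rfl⟩ := hp
    exact ⟨hb, e.symm⟩
  · rintro ⟨a, b⟩ hp ⟨a', b'⟩ hp' e
    simp only [Finset.coe_filter, Set.mem_ofPred_eq, Finset.mem_filter] at hp hp' e
    rw [hp.2, hp'.2, e]

theorem exists_injOn_lt (V : Finset ℕ) {n : ℕ} (hn : V.card ≤ n) :
    ∃ f : ℕ → ℕ, Set.InjOn f V ∧ ∀ v ∈ V, f v < n := by
  have hsub : ∀ v ∈ V, (V.filter fun u => u < v) ⊂ V := fun v hv =>
    Finset.filter_ssubset.2 ⟨v, hv, lt_irrefl v⟩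
  have hmono : ∀ v ∈ V, ∀ w ∈ V, v < w →
      (V.filter fun u => u < v).card < (V.filter fun u => u < w).card := fun v hv w _ h => by
    refine Finset.card_lt_card ⟨fun u hu => ?_, fun hs => ?_⟩
    · simp only [Finset.mem_filter] at hu ⊢
      exact ⟨hu.1, hu.2.trans h⟩
    · simpa using hs (Finset.mem_filter.2 ⟨hv, h⟩)
  refine ⟨fun v => (V.filter fun u => u < v).card, fun v hv w hw e => ?_, fun v hv =>
    (Finset.card_lt_card (hsub v hv)).trans_le hn⟩
  rcases lt_trichotomy v w with h | h | h
  · exact absurd e (hmono v hv w hw h).ne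
  · exact h
  · exact absurd e (hmono w hw v hv h).ne'

theorem sum_div_le {V : Finset ℕ} {f : ℕ → ℕ} (hf : Set.InjOn f V) {n r : ℕ}
    (hlt : ∀ v ∈ V, f v < n) : 2 * r * ∑ v ∈ V, f v / r ≤ n ^ 2 := by
  have h1 : ∑ v ∈ V, f v ≤ ∑ k ∈ Finset.range n, k := by
    rw [← Finset.sum_image (s := V) (g := f) (f := fun k => k) hf]
    refine Finset.sum_le_sum_of_subset fun k hk => ?_
    obtain ⟨v, hv, rfl⟩ := Finset.mem_image.1 hk
    simpa using hlt v hv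
  have h2 : r * ∑ v ∈ V, f v / r ≤ ∑ v ∈ V, f v := by
    rw [Finset.mul_sum]
    exact Finset.sum_le_sum fun v _ => Nat.mul_div_le _ _
  have h3 := Finset.sum_range_id_mul_two n
  have h4 : n * (n - 1) ≤ n ^ 2 := by
    rw [pow_two]; exact Nat.mul_le_mul_left n (Nat.sub_le n 1)
  nlinarith

theorem pair_eq_pair_iff {α : Type*} [DecidableEq α] {a b c d : α} :
    ({a, b} : Finset α) = {c, d} ↔ a = c ∧ b = d ∨ a = d ∧ b = c := by
  rw [← Finset.coe_inj]
  push_cast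
  exact Set.pair_eq_pair_iff

/-- A clause of a monotone 2-CNF formula is a pair of positive literals. -/
theorem exists_eq_pair_of_monotone {φ : Formula} (h2 : Is2CNF φ) (hm : MonotoneFormula φ)
    {C : Clause} (hC : C ∈ φ) :
    ∃ i ∈ Vars φ, ∃ j ∈ Vars φ, C = {(i, true), (j, true)} := by
  obtain ⟨⟨i, b⟩, ⟨j, d⟩, -, rfl⟩ := Finset.card_eq_two.1 (h2 C hC).2
  have h1 : b = true := hm _ hC (i, b) (by simp)
  have h2 : d = true := hm _ hC (j, d) (by simp)
  subst h1 h2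
  exact ⟨i, mem_Vars.2 ⟨_, hC, (i, true), by simp, rfl⟩, j,
    mem_Vars.2 ⟨_, hC, (j, true), by simp, rfl⟩, rfl⟩

/-- Two rounds of edge-disjoint biclique replacements, with rows in groups of size `r` and columns
in blocks of size `c`. The first round shares the columns having the same neighbourhood in a row
group, the second one pairs up columns of the same block. -/
theorem exists_bvaChain_card_le {n r c : ℕ} (hr : 0 < r) (hc : 0 < c) {φ : Formula}
    (h2 : Is2CNF φ) (hm : MonotoneFormula φ) (hn : (Vars φ).card ≤ n) :
    ∃ (φ' : Formula) (D : ℕ), Is2CNF φ' ∧ BVAChain φ φ' ∧ 2 * r * D ≤ n ^ 2 ∧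
      2 * φ'.card ≤ 2 * (n * r + n * 2 ^ r + n * c) + D
        + (n / r + 1) * 2 ^ r * (n / c + 1) := by
  classical
  obtain ⟨f, hf, hlt⟩ := exists_injOn_lt (Vars φ) hn
  obtain ⟨V, hV⟩ : ∃ V, V = Vars φ := ⟨_, rfl⟩
  rw [← hV] at hf hlt hn
  obtain ⟨M, hM⟩ : ∃ M, ∀ v ∈ V, v < M :=
    ⟨V.sup id + 1, fun v hv => Nat.lt_succ_of_le (Finset.le_sup (f := id) hv)⟩
  have hpair : ∀ C ∈ φ, ∃ i ∈ V, ∃ j ∈ V, C = {(i, true), (j, true)} := fun C hC =>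
    hV ▸ exists_eq_pair_of_monotone h2 hm hC
  obtain ⟨R, hR⟩ : ∃ R : ℕ → Finset ℕ, ∀ g, R g = V.filter fun i => f i / r = g :=
    ⟨_, fun _ => rfl⟩
  obtain ⟨P, hP⟩ : ∃ P : ℕ → ℕ → Finset ℕ, ∀ g j,
      P g j = (R g).filter fun i => ({(i, true), (j, true)} : Clause) ∈ φ :=
    ⟨_, fun _ _ => rfl⟩
  have hPR : ∀ g j, P g j ∈ (R g).powerset := fun g j => by
    rw [hP]; exact Finset.mem_powerset.2 (Finset.filter_subset _ _)
  obtain ⟨T, hT⟩ : ∃ T : (Σ _ : ℕ, Finset ℕ) → Finset ℕ, ∀ a,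
      T a = (V.filter fun j => a.1 < f j / r).filter fun j => P a.1 j = a.2 :=
    ⟨_, fun _ => rfl⟩
  have memT : ∀ a j, j ∈ T a ↔ (j ∈ V ∧ a.1 < f j / r) ∧ P a.1 j = a.2 := fun a j => by
    rw [hT, Finset.mem_filter, Finset.mem_filter]
  obtain ⟨s₁, hs₁⟩ : ∃ s₁ : Finset (Σ _ : ℕ, Finset ℕ),
      s₁ = (Finset.range (n / r + 1)).sigma fun g => (R g).powerset := ⟨_, rfl⟩
  have rowV : ∀ a ∈ s₁, ∀ i ∈ a.2, i ∈ V ∧ f i / r = a.1 := fun a ha i hi => by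
    rw [hs₁, Finset.mem_sigma, Finset.mem_powerset, hR] at ha
    exact Finset.mem_filter.1 (ha.2 hi)
  choose 𝒬 hQ₁ hQ₂ hQ₃ hQ₄ using fun a => exists_pairing (fun j => f j / c) (n / c + 1) (T a)
    (fun j hj => Nat.lt_succ_of_le (Nat.div_le_div_right (hlt j ((memT a j).1 hj).1.1).le))
  obtain ⟨s₂, hs₂⟩ : ∃ s₂ : Finset (Finset ℕ), s₂ = s₁.biUnion 𝒬 := ⟨_, rfl⟩
  have colV : ∀ Q ∈ s₂, ∀ j ∈ Q, j ∈ V := fun Q hQ j hj => by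
    rw [hs₂] at hQ
    obtain ⟨a, -, ha⟩ := Finset.mem_biUnion.1 hQ
    exact ((memT a j).1 ((hQ₁ a Q ha).1 hj)).1.1
  obtain ⟨z, hz⟩ : ∃ z : (Σ _ : ℕ, Finset ℕ) → ℕ, ∀ a, z a = M + 2 * Encodable.encode a :=
    ⟨_, fun _ => rfl⟩
  obtain ⟨w, hw⟩ : ∃ w : Finset ℕ → ℕ, ∀ Q, w Q = M + 2 * Encodable.encode Q + 1 :=
    ⟨_, fun _ => rfl⟩
  have zinj : ∀ a b, z a = z b → a = b := fun a b h => by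
    rw [hz, hz] at h; exact Encodable.encode_injective (by omega)
  have winj : ∀ a b, w a = w b → a = b := fun a b h => by
    rw [hw, hw] at h; exact Encodable.encode_injective (by omega)
  have zV : ∀ a, ∀ v ∈ V, v ≠ z a := fun a v hv => by
    have := hM v hv; rw [hz]; omega
  have wV : ∀ a, ∀ v ∈ V, v ≠ w a := fun a v hv => by
    have := hM v hv; rw [hw]; omega
  have zw : ∀ a Q, z a ≠ w Q := fun a Q => by rw [hz, hw]; omega
  -- first round
  obtain ⟨X₁, hX₁⟩ : ∃ X₁ : (Σ _ : ℕ, Finset ℕ) → Finset Lit,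
      ∀ a l, l ∈ X₁ a ↔ ∃ i ∈ a.2, l = (i, true) :=
    ⟨fun a => a.2.image fun i => (i, true), fun a l => by simp only [Finset.mem_image, eq_comm]⟩
  obtain ⟨Y₁, hY₁⟩ : ∃ Y₁ : (Σ _ : ℕ, Finset ℕ) → Finset Lit,
      ∀ a l, l ∈ Y₁ a ↔ ∃ j ∈ T a, l = (j, true) :=
    ⟨fun a => (T a).image fun i => (i, true), fun a l => by simp only [Finset.mem_image, eq_comm]⟩
  have step₁ : BVAChain φ (bicliqueReplace φ s₁ z X₁ Y₁) := by
    refine bvaChain_bicliqueReplace φ s₁ z X₁ Y₁ (fun a _ b _ h => zinj a b h) ?_ ?_ ?_ ?_ ?_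
    · intro a _ h
      exact zV a _ (hV ▸ h) rfl
    · intro a ha x hx b _
      obtain ⟨i, hi, rfl⟩ := (hX₁ a x).1 hx
      exact zV b i (rowV a ha i hi).1
    · intro a ha y hy b _
      obtain ⟨j, hj, rfl⟩ := (hY₁ a y).1 hy
      exact zV b j ((memT a j).1 hj).1.1
    · intro a ha C hC
      obtain ⟨x, hx, y, hy, rfl⟩ := mem_pairClauses.1 hC
      obtain ⟨i, hi, rfl⟩ := (hX₁ a x).1 hx
      obtain ⟨j, hj, rfl⟩ := (hY₁ a y).1 hy
      rw [← ((memT a j).1 hj).2, hP] at hi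
      exact (Finset.mem_filter.1 hi).2
    · intro a ha b hb C hC hC'
      obtain ⟨x, hx, y, hy, rfl⟩ := mem_pairClauses.1 hC
      obtain ⟨i, hi, rfl⟩ := (hX₁ a x).1 hx
      obtain ⟨j, hj, rfl⟩ := (hY₁ a y).1 hy
      obtain ⟨x', hx', y', hy', e⟩ := mem_pairClauses.1 hC'
      obtain ⟨i', hi', rfl⟩ := (hX₁ b x').1 hx'
      obtain ⟨j', hj', rfl⟩ := (hY₁ b y').1 hy'
      have hi := rowV a ha i hi
      have hi' := rowV b hb i' hi'
      have hj := (memT a j).1 hj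
      have hj' := (memT b j').1 hj'
      rcases pair_eq_pair_iff.1 e with ⟨e₁, e₂⟩ | ⟨e₁, e₂⟩
      · simp only [Prod.mk.injEq, and_true] at e₁ e₂
        subst e₁ e₂
        have h1 : a.1 = b.1 := hi.2.symm.trans hi'.2
        have h3 : a.2 = b.2 := by rw [← hj.2, ← hj'.2, h1]
        exact Sigma.ext h1 (heq_of_eq h3)
      · simp only [Prod.mk.injEq, and_true] at e₁ e₂
        subst e₁ e₂
        have := hj.1.2
        have := hj'.1.2
        omega
  obtain ⟨φ₁, hφ₁⟩ : ∃ φ₁, φ₁ = bicliqueReplace φ s₁ z X₁ Y₁ := ⟨_, rfl⟩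
  rw [← hφ₁] at step₁
  have memφ₁ : ∀ C, C ∈ φ₁ →
      (∃ i ∈ V, ∃ j ∈ V, f i / r = f j / r ∧ C ∈ φ ∧ C = {(i, true), (j, true)}) ∨
      (∃ a ∈ s₁, ∃ i ∈ a.2, C = {(z a, true), (i, true)}) ∨
      (∃ a ∈ s₁, ∃ j ∈ T a, C = {(z a, false), (j, true)}) := by
    intro C hC
    rw [hφ₁] at hC
    rcases mem_bicliqueReplace.1 hC with ⟨h, hno⟩ | ⟨a, ha, x, hx, rfl⟩ | ⟨a, ha, y, hy, rfl⟩
    · obtain ⟨i, hi, j, hj, rfl⟩ := hpair C h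
      have key : ∀ i ∈ V, ∀ j ∈ V, ({(i, true), (j, true)} : Clause) ∈ φ → f i / r < f j / r →
          ∃ a ∈ s₁, ({(i, true), (j, true)} : Clause) ∈ pairClauses (X₁ a) (Y₁ a) := by
        intro i hi j hj h hij
        refine ⟨⟨f i / r, P (f i / r) j⟩, ?_, mem_pairClauses.2 ⟨_, (hX₁ _ _).2 ⟨i, ?_, rfl⟩, _,
          (hY₁ _ _).2 ⟨j, (memT _ _).2 ⟨⟨hj, hij⟩, rfl⟩, rfl⟩, rfl⟩⟩
        · rw [hs₁, Finset.mem_sigma]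
          exact ⟨Finset.mem_range.2 (Nat.lt_succ_of_le (Nat.div_le_div_right (hlt i hi).le)),
            hPR _ _⟩
        · change i ∈ P (f i / r) j
          rw [hP, hR]
          exact Finset.mem_filter.2 ⟨Finset.mem_filter.2 ⟨hi, rfl⟩, h⟩
      rcases lt_trichotomy (f i / r) (f j / r) with hij | hij | hij
      · obtain ⟨a, ha, h'⟩ := key i hi j hj h hij
        exact absurd h' (hno a ha)
      · exact Or.inl ⟨i, hi, j, hj, hij, h, rfl⟩
      · obtain ⟨a, ha, h'⟩ := key j hj i hi (by rwa [Finset.pair_comm]) hij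
        exact absurd (by rwa [Finset.pair_comm]) (hno a ha)
    · obtain ⟨i, hi, rfl⟩ := (hX₁ a x).1 hx
      exact Or.inr (Or.inl ⟨a, ha, i, hi, rfl⟩)
    · obtain ⟨j, hj, rfl⟩ := (hY₁ a y).1 hy
      exact Or.inr (Or.inr ⟨a, ha, j, hj, rfl⟩)
  -- second round
  obtain ⟨X₂, hX₂⟩ : ∃ X₂ : Finset ℕ → Finset Lit,
      ∀ Q l, l ∈ X₂ Q ↔ ∃ a, (a ∈ s₁ ∧ Q ∈ 𝒬 a) ∧ l = (z a, false) :=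
    ⟨fun Q => (s₁.filter fun a => Q ∈ 𝒬 a).image fun a => (z a, false), fun a l => by
      simp only [Finset.mem_image, Finset.mem_filter, eq_comm]⟩
  obtain ⟨Y₂, hY₂⟩ : ∃ Y₂ : Finset ℕ → Finset Lit,
      ∀ Q l, l ∈ Y₂ Q ↔ ∃ j ∈ Q, l = (j, true) :=
    ⟨fun Q => Q.image fun j => (j, true), fun a l => by simp only [Finset.mem_image, eq_comm]⟩
  have step₂ : BVAChain φ₁ (bicliqueReplace φ₁ s₂ w X₂ Y₂) := by
    refine bvaChain_bicliqueReplace φ₁ s₂ w X₂ Y₂ (fun a _ b _ h => winj a b h) ?_ ?_ ?_ ?_ ?_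
    · intro Q _ h
      obtain ⟨C, hC, l, hl, hlw⟩ := mem_Vars.1 h
      rcases memφ₁ C hC with ⟨i, hi, j, hj, -, -, rfl⟩ | ⟨a, ha, i, hi, rfl⟩ | ⟨a, ha, j, hj, rfl⟩
        <;> simp only [Finset.mem_insert, Finset.mem_singleton] at hl
        <;> rcases hl with rfl | rfl
      · exact wV Q i hi hlw
      · exact wV Q j hj hlw
      · exact zw a Q hlw
      · exact wV Q i (rowV a ha i hi).1 hlw
      · exact zw a Q hlw
      · exact wV Q j ((memT a j).1 hj).1.1 hlw
    · intro Q _ x hx Q' _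
      obtain ⟨a, -, rfl⟩ := (hX₂ Q x).1 hx
      exact zw a Q'
    · intro Q hQ y hy Q' _
      obtain ⟨j, hj, rfl⟩ := (hY₂ Q y).1 hy
      exact wV Q' j (colV Q hQ j hj)
    · intro Q hQ C hC
      obtain ⟨x, hx, y, hy, rfl⟩ := mem_pairClauses.1 hC
      obtain ⟨a, ⟨ha, hQa⟩, rfl⟩ := (hX₂ Q x).1 hx
      obtain ⟨j, hj, rfl⟩ := (hY₂ Q y).1 hy
      rw [hφ₁]
      exact mem_bicliqueReplace.2
        (Or.inr (Or.inr ⟨a, ha, _, (hY₁ a _).2 ⟨j, (hQ₁ a Q hQa).1 hj, rfl⟩, rfl⟩))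
    · intro Q hQ Q' hQ' C hC hC'
      obtain ⟨x, hx, y, hy, rfl⟩ := mem_pairClauses.1 hC
      obtain ⟨a, ⟨ha, hQa⟩, rfl⟩ := (hX₂ Q x).1 hx
      obtain ⟨j, hj, rfl⟩ := (hY₂ Q y).1 hy
      obtain ⟨x', hx', y', hy', e⟩ := mem_pairClauses.1 hC'
      obtain ⟨b, ⟨hb, hQb⟩, rfl⟩ := (hX₂ Q' x').1 hx'
      obtain ⟨j', hj', rfl⟩ := (hY₂ Q' y').1 hy'
      rcases pair_eq_pair_iff.1 e with ⟨e₁, e₂⟩ | ⟨e₁, e₂⟩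
      · simp only [Prod.mk.injEq, and_true] at e₁ e₂
        obtain rfl := zinj a b e₁
        subst e₂
        exact hQ₃ a Q hQa Q' hQb j hj hj'
      · simp at e₁
  obtain ⟨φ₂, hφ₂⟩ : ∃ φ₂, φ₂ = bicliqueReplace φ₁ s₂ w X₂ Y₂ := ⟨_, rfl⟩
  rw [← hφ₂] at step₂
  have memφ₂ : ∀ C, C ∈ φ₂ →
      (∃ i ∈ V, ∃ j ∈ V, f i / r = f j / r ∧ C ∈ φ ∧ C = {(i, true), (j, true)}) ∨
      (∃ a ∈ s₁, ∃ i ∈ a.2, C = {(z a, true), (i, true)}) ∨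
      (∃ a ∈ s₁, ∃ Q ∈ 𝒬 a, C = {(w Q, true), (z a, false)}) ∨
      (∃ a ∈ s₁, ∃ Q ∈ 𝒬 a, ∃ j ∈ Q, C = {(w Q, false), (j, true)}) := by
    intro C hC
    rw [hφ₂] at hC
    rcases mem_bicliqueReplace.1 hC with ⟨h, hno⟩ | ⟨Q, hQ, x, hx, rfl⟩ | ⟨Q, hQ, y, hy, rfl⟩
    · rcases memφ₁ C h with h | h | ⟨a, ha, j, hj, rfl⟩
      · exact Or.inl h
      · exact Or.inr (Or.inl h)
      · obtain ⟨Q, hQ, hjQ⟩ := hQ₂ a j hj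
        exact absurd (mem_pairClauses.2 ⟨_, (hX₂ Q _).2 ⟨a, ⟨ha, hQ⟩, rfl⟩, _,
          (hY₂ Q _).2 ⟨j, hjQ, rfl⟩, rfl⟩)
          (hno Q (by rw [hs₂]; exact Finset.mem_biUnion.2 ⟨a, ha, hQ⟩))
    · obtain ⟨a, ⟨ha, hQa⟩, rfl⟩ := (hX₂ Q x).1 hx
      exact Or.inr (Or.inr (Or.inl ⟨a, ha, Q, hQa, rfl⟩))
    · obtain ⟨j, hj, rfl⟩ := (hY₂ Q y).1 hy
      rw [hs₂] at hQ
      obtain ⟨a, ha, hQa⟩ := Finset.mem_biUnion.1 hQ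
      exact Or.inr (Or.inr (Or.inr ⟨a, ha, Q, hQa, j, hj, rfl⟩))
  refine ⟨φ₂, ∑ v ∈ V, f v / r, ?_, step₁.trans step₂, sum_div_le hf hlt, ?_⟩
  · intro C hC
    rcases memφ₂ C hC with ⟨-, -, -, -, -, h, -⟩ | ⟨a, ha, i, hi, rfl⟩ | ⟨a, ha, Q, hQ, rfl⟩ |
      ⟨a, ha, Q, hQ, j, hj, rfl⟩
    · exact h2 C h
    · exact isClause_pair_and_card (zV a i (rowV a ha i hi).1).symm
    · exact isClause_pair_and_card (zw a Q).symm
    · exact isClause_pair_and_card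
        (wV Q j ((memT a j).1 ((hQ₁ a Q hQ).1 hj)).1.1).symm
  -- counting
  let E₀ : Formula := ((V ×ˢ V).filter fun p => f p.1 / r = f p.2 / r).image
    fun p => {(p.1, true), (p.2, true)}
  let E₁ : Formula := (V.sigma fun i => (R (f i / r)).powerset).image
    fun p => {(z ⟨f p.1 / r, p.2⟩, true), (p.1, true)}
  let E₂ : Formula := (s₁.sigma 𝒬).image fun p => {(w p.2, true), (z p.1, false)}
  let E₃ : Formula := ((V ×ˢ V).filter fun p => f p.1 / c = f p.2 / c).image
    fun p => {(w {p.1, p.2}, false), (p.1, true)}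
  have hsub : φ₂ ⊆ E₀ ∪ E₁ ∪ E₂ ∪ E₃ := by
    intro C hC
    simp only [Finset.mem_union]
    rcases memφ₂ C hC with ⟨i, hi, j, hj, e, -, rfl⟩ | ⟨a, ha, i, hi, rfl⟩ | ⟨a, ha, Q, hQ, rfl⟩ |
      ⟨a, ha, Q, hQ, j, hj, rfl⟩
    · exact Or.inl (Or.inl (Or.inl (Finset.mem_image.2 ⟨(i, j),
        Finset.mem_filter.2 ⟨Finset.mem_product.2 ⟨hi, hj⟩, e⟩, rfl⟩)))
    · refine Or.inl (Or.inl (Or.inr (Finset.mem_image.2 ⟨⟨i, a.2⟩, ?_, ?_⟩)))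
      · rw [hs₁, Finset.mem_sigma] at ha
        rw [Finset.mem_sigma]
        have h1 := ha.2
        rw [Finset.mem_powerset] at h1
        have h3 := h1 hi
        rw [hR, Finset.mem_filter] at h3
        refine ⟨h3.1, ?_⟩
        rw [h3.2]
        exact ha.2
      · change ({(z ⟨f i / r, a.2⟩, true), (i, true)} : Clause) = _
        rw [(rowV a ha i hi).2]
    · exact Or.inl (Or.inr (Finset.mem_image.2 ⟨⟨a, Q⟩, Finset.mem_sigma.2 ⟨ha, hQ⟩, rfl⟩))
    · right
      obtain ⟨hQT, hQc, hQb⟩ := hQ₁ a Q hQ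
      have hQV : ∀ j ∈ Q, j ∈ V := fun j hj => ((memT a j).1 (hQT hj)).1.1
      obtain ⟨j', hj', rfl⟩ : ∃ j' ∈ Q, Q = {j, j'} := by
        rcases (Q.erase j).eq_empty_or_nonempty with h | ⟨j', h⟩
        · refine ⟨j, hj, ?_⟩
          rw [← Finset.insert_erase hj, h]
          simp
        · refine ⟨j', Finset.mem_of_mem_erase h, ?_⟩
          have h1 : (Q.erase j).card ≤ 1 := by rw [Finset.card_erase_of_mem hj]; omega
          have h3 : Q.erase j = {j'} := Finset.eq_singleton_iff_unique_mem.2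
            ⟨h, fun x hx => Finset.card_le_one.1 h1 x hx j' h⟩
          rw [← h3, Finset.insert_erase hj]
      exact Finset.mem_image.2 ⟨(j, j'), Finset.mem_filter.2
        ⟨Finset.mem_product.2 ⟨hQV j hj, hQV j' hj'⟩, hQb j hj j' hj'⟩, rfl⟩
  have hRcard : ∀ g, (R g).powerset.card ≤ 2 ^ r := fun g => by
    rw [Finset.card_powerset, hR]
    exact Nat.pow_le_pow_right two_pos (card_filter_div_eq_le hf hr g)
  have c₀ : E₀.card ≤ n * r := Finset.card_image_le.trans (card_filter_div_eq_div_le hf hr hn)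
  have c₃ : E₃.card ≤ n * c := Finset.card_image_le.trans (card_filter_div_eq_div_le hf hc hn)
  have c₁ : E₁.card ≤ n * 2 ^ r := by
    refine Finset.card_image_le.trans ?_
    rw [Finset.card_sigma]
    refine (Finset.sum_le_card_nsmul V _ (2 ^ r) fun i _ => hRcard _).trans ?_
    rw [smul_eq_mul]
    exact Nat.mul_le_mul_right _ hn
  have hs₁card : s₁.card ≤ (n / r + 1) * 2 ^ r := by
    rw [hs₁, Finset.card_sigma]
    refine (Finset.sum_le_card_nsmul _ _ (2 ^ r) fun i _ => hRcard _).trans ?_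
    simp
  have hTsum : ∑ a ∈ s₁, (T a).card ≤ ∑ v ∈ V, f v / r := by
    have h1 : ∀ g, ∑ S ∈ (R g).powerset, (T ⟨g, S⟩).card
        = (V.filter fun j => g < f j / r).card := fun g => by
      rw [Finset.card_eq_sum_card_fiberwise (f := fun j => P g j) (t := (R g).powerset)
        (fun j _ => hPR g j)]
      exact Finset.sum_congr rfl fun S _ => by rw [hT]
    rw [hs₁, Finset.sum_sigma]
    simp only [h1, Finset.card_filter]
    rw [Finset.sum_comm]
    refine Finset.sum_le_sum fun v _ => ?_
    rw [← Finset.card_filter]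
    refine (Finset.card_le_card fun g hg => ?_).trans (Finset.card_range (f v / r)).le
    exact Finset.mem_range.2 (Finset.mem_filter.1 hg).2
  have c₂ : 2 * E₂.card ≤ ∑ v ∈ V, f v / r + (n / r + 1) * 2 ^ r * (n / c + 1) := by
    have h1 : E₂.card ≤ ∑ a ∈ s₁, (𝒬 a).card :=
      Finset.card_image_le.trans (Finset.card_sigma _ _).le
    have h3 : 2 * ∑ a ∈ s₁, (𝒬 a).card ≤ ∑ a ∈ s₁, ((T a).card + (n / c + 1)) := by
      rw [Finset.mul_sum]
      exact Finset.sum_le_sum fun a _ => hQ₄ a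
    rw [Finset.sum_add_distrib, Finset.sum_const, smul_eq_mul] at h3
    have h4 := Nat.mul_le_mul_right (n / c + 1) hs₁card
    omega
  have hcard := Finset.card_le_card hsub
  have u₁ := Finset.card_union_le (E₀ ∪ E₁ ∪ E₂) E₃
  have u₂ := Finset.card_union_le (E₀ ∪ E₁) E₂
  have u₃ := Finset.card_union_le E₀ E₁
  omega

theorem eventually_natLog_le (δ : ℝ) (hδ : 0 < δ) :
    ∀ᶠ L : ℕ in Filter.atTop, (Nat.log 2 L : ℝ) ≤ δ * L := by
  have hlog : 0 < Real.log 2 := Real.log_pos one_lt_two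
  have h := (Real.isLittleO_log_id_atTop.bound (mul_pos hδ hlog)).natCast_atTop
  filter_upwards [h, Filter.eventually_ge_atTop 1] with L hL h1
  have h2 : (Nat.log 2 L : ℝ) ≤ Real.logb 2 L := by exact_mod_cast Real.natLog_le_logb L 2
  refine h2.trans ?_
  rw [Real.logb, div_le_iff₀ hlog]
  simp only [id, Real.norm_natCast] at hL
  calc Real.log L ≤ ‖Real.log (L : ℝ)‖ := le_abs_self _
    _ ≤ _ := hL
    _ = δ * L * Real.log 2 := by ring

theorem eventually_pow_three_le : ∀ᶠ L : ℕ in Filter.atTop, L ^ 3 ≤ 2 ^ L := by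
  have h := (isLittleO_pow_const_const_pow_of_one_lt (R := ℝ) 3 one_lt_two).bound one_pos
  filter_upwards [h] with L hL
  rw [one_mul, Real.norm_of_nonneg (by positivity), Real.norm_of_nonneg (by positivity)] at hL
  exact_mod_cast hL

/-- The estimate for one value `L` of the integer part of `log₂ n`. -/
theorem add_one_mul_le {ε δ L r : ℝ} (hδ : 0 < δ) (h6 : δ ≤ 1 / 6) (h4 : 4 * δ ≤ ε)
    (hL : 1 ≤ δ * L) (hL1 : 1 ≤ L) (hLε : 124 ≤ ε * L) (hr : (1 - 3 * δ) * L ≤ r) :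
    (L + 1) * (1 / (4 * r) + 31 / L ^ 2) ≤ 1 / 4 + ε := by
  have hL0 : 0 < L := by linarith
  have hr0 : 0 < r := lt_of_lt_of_le (mul_pos (by linarith) hL0) hr
  have h1 : (L + 1) * (1 / (4 * r)) ≤ 1 / 4 + ε / 2 := by
    rw [mul_one_div, div_le_iff₀ (by positivity)]
    have e1 : L + 1 ≤ (1 + δ) * L := by linarith
    have e2 : (1 + δ) * L ≤ (1 + 2 * ε) * ((1 - 3 * δ) * L) := by
      rw [← mul_assoc]
      refine mul_le_mul_of_nonneg_right ?_ hL0.le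
      nlinarith
    have e3 : (1 + 2 * ε) * ((1 - 3 * δ) * L) ≤ (1 + 2 * ε) * r :=
      mul_le_mul_of_nonneg_left hr (by linarith)
    linarith
  have h2 : (L + 1) * (31 / L ^ 2) ≤ ε / 2 := by
    rw [mul_div_assoc', div_le_iff₀ (by positivity)]
    nlinarith
  rw [mul_add]
  linarith

/-- Every term but the main one of the size bound is `O(n² / L²)`. -/
theorem size_bound_le {n L r c q D s : ℕ} (hL : 1 ≤ L) (hLn : L ^ 3 ≤ n) (hr : L ≤ 2 * r)
    (hrL : r ≤ L) (hq : 1 ≤ q) (hqL : q * L ^ 3 ≤ 8 * n) (hc : c = q * L)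
    (hD : 2 * r * D ≤ n ^ 2)
    (hs : 2 * s ≤ 2 * (n * r + n * q + n * c) + D + (n / r + 1) * q * (n / c + 1)) :
    (s : ℝ) ≤ (n : ℝ) ^ 2 * (1 / (4 * r) + 31 / (L : ℝ) ^ 2) := by
  have hL' : (1 : ℝ) ≤ L := by exact_mod_cast hL
  have hLn' : (L : ℝ) ^ 3 ≤ n := by exact_mod_cast hLn
  have hr' : (L : ℝ) ≤ 2 * r := by exact_mod_cast hr
  have hrL' : (r : ℝ) ≤ L := by exact_mod_cast hrL
  have hq' : (1 : ℝ) ≤ q := by exact_mod_cast hq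
  have hqL' : (q : ℝ) * L ^ 3 ≤ 8 * n := by exact_mod_cast hqL
  have hc' : (c : ℝ) = q * L := by exact_mod_cast hc
  have hD' : 2 * (r : ℝ) * D ≤ n ^ 2 := by exact_mod_cast hD
  have hs' : 2 * (s : ℝ) ≤ 2 * (n * r + n * q + n * c) + D
      + (((n / r : ℕ) : ℝ) + 1) * q * (((n / c : ℕ) : ℝ) + 1) := by exact_mod_cast hs
  have hL0 : (0 : ℝ) < L := by linarith
  have hr0 : (0 : ℝ) < r := by linarith
  have hn0 : (0 : ℝ) ≤ n := Nat.cast_nonneg n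
  obtain ⟨x, hx⟩ : ∃ x : ℝ, x = n / L := ⟨_, rfl⟩
  have hnx : (n : ℝ) = x * L := by rw [hx]; field_simp
  have hx1 : (L : ℝ) ^ 2 ≤ x := by
    rw [hx, le_div_iff₀ hL0]; linarith [pow_succ (L : ℝ) 2]
  have hx0 : 0 ≤ x := le_trans (by positivity) hx1
  have hqx : (q : ℝ) * L ^ 2 ≤ 8 * x := by
    refine le_of_mul_le_mul_right ?_ hL0
    rw [hnx] at hqL'
    linarith [pow_succ (L : ℝ) 2]
  have hL2 : (L : ℝ) ≤ L ^ 2 := by nlinarith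
  have t₁ : (n : ℝ) * r ≤ x ^ 2 := by
    calc (n : ℝ) * r ≤ x * L * L := by rw [hnx]; gcongr
      _ = x * L ^ 2 := by ring
      _ ≤ x * x := by gcongr
      _ = x ^ 2 := by ring
  have t₂ : (n : ℝ) * q ≤ 8 * x ^ 2 := by
    calc (n : ℝ) * q = x * (q * L) := by rw [hnx]; ring
      _ ≤ x * (q * L ^ 2) := by gcongr
      _ ≤ x * (8 * x) := by gcongr
      _ = 8 * x ^ 2 := by ring
  have t₃ : (n : ℝ) * c ≤ 8 * x ^ 2 := by
    calc (n : ℝ) * c = x * (q * L ^ 2) := by rw [hnx, hc']; ring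
      _ ≤ x * (8 * x) := by gcongr
      _ = 8 * x ^ 2 := by ring
  have t₄ : ((n / r : ℕ) : ℝ) + 1 ≤ 3 * x := by
    have h1 : ((n / r : ℕ) : ℝ) ≤ 2 * x := by
      refine Nat.cast_div_le.trans ?_
      rw [div_le_iff₀ hr0, hnx]
      nlinarith
    nlinarith
  have t₅ : (q : ℝ) * (((n / c : ℕ) : ℝ) + 1) ≤ 9 * x := by
    have h1 : ((n / c : ℕ) : ℝ) ≤ x / q := by
      refine Nat.cast_div_le.trans (le_of_eq ?_)
      rw [hc', hnx]; field_simp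
    have h2 : (q : ℝ) * ((n / c : ℕ) : ℝ) ≤ x := by
      rw [le_div_iff₀ (by linarith)] at h1; linarith
    nlinarith
  have t₆ : (((n / r : ℕ) : ℝ) + 1) * q * (((n / c : ℕ) : ℝ) + 1) ≤ 27 * x ^ 2 := by
    calc _ = (((n / r : ℕ) : ℝ) + 1) * (q * (((n / c : ℕ) : ℝ) + 1)) := by ring
      _ ≤ (3 * x) * (9 * x) := by gcongr
      _ = 27 * x ^ 2 := by ring
  have t₇ : (D : ℝ) ≤ 2 * (n ^ 2 * (1 / (4 * r))) := by
    have : 2 * ((n : ℝ) ^ 2 * (1 / (4 * r))) = n ^ 2 / (2 * r) := by field_simp; ring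
    rw [this, le_div_iff₀ (by positivity)]
    linarith
  have t₈ : (n : ℝ) ^ 2 * (31 / (L : ℝ) ^ 2) = 31 * x ^ 2 := by rw [hx]; ring
  rw [mul_add, t₈]
  nlinarith [sq_nonneg x]

/-- idealized BVA upper bound for monotone 2-CNF formulas. -/
theorem bva_monotone_upper (ε : ℝ) (hε : 0 < ε) :
    ∃ N : ℕ, ∀ n : ℕ, N ≤ n → ∀ φ : Formula, Is2CNF φ → MonotoneFormula φ →
      (Vars φ).card ≤ n →
      ∃ φ' : Formula, Is2CNF φ' ∧ BVAChain φ φ' ∧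
        (φ'.card : ℝ) ≤ (1 / 4 + ε) * (n : ℝ) ^ 2 / Real.logb 2 (n : ℝ) := by
  obtain ⟨δ, hδ⟩ : ∃ δ : ℝ, δ = min (1 / 6) (ε / 4) := ⟨_, rfl⟩
  have hδ0 : 0 < δ := by rw [hδ]; positivity
  have hδ6 : δ ≤ 1 / 6 := hδ ▸ min_le_left _ _
  have hδ4 : δ ≤ ε / 4 := hδ ▸ min_le_right _ _
  have hlin : ∀ a b : ℝ, 0 < a → ∀ᶠ L : ℕ in Filter.atTop, b ≤ a * (L : ℝ) := fun a b ha =>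
    (tendsto_natCast_atTop_atTop.const_mul_atTop ha).eventually_ge_atTop b
  obtain ⟨L₀, hL₀⟩ := Filter.eventually_atTop.1 ((eventually_natLog_le δ hδ0).and
    (eventually_pow_three_le.and ((hlin δ 1 hδ0).and ((hlin ε 124 hε).and
      (Filter.eventually_ge_atTop 1)))))
  refine ⟨2 ^ L₀, fun n hn φ h2 hm hV => ?_⟩
  have hn0 : n ≠ 0 := (lt_of_lt_of_le (by positivity) hn).ne'
  obtain ⟨L, hL⟩ : ∃ L, L = Nat.log 2 n := ⟨_, rfl⟩
  have hLL : L₀ ≤ L := hL ▸ Nat.le_log_of_pow_le one_lt_two hn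
  obtain ⟨hlog, hcube, hδL, hεL, hL1⟩ := hL₀ L hLL
  have hLn : 2 ^ L ≤ n := hL ▸ Nat.pow_log_le_self 2 hn0
  have hnL : n < 2 ^ (L + 1) := hL ▸ Nat.lt_pow_succ_log_self one_lt_two n
  obtain ⟨l, hl⟩ : ∃ l, l = Nat.log 2 L := ⟨_, rfl⟩
  rw [← hl] at hlog
  have hL0 : (0 : ℝ) < L := by exact_mod_cast hL1
  have h6l : 6 * l ≤ L := by
    have : (6 : ℝ) * l ≤ L := by nlinarith
    exact_mod_cast this
  have hLl : L < 2 ^ (l + 1) := hl ▸ Nat.lt_pow_succ_log_self one_lt_two L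
  obtain ⟨r, hr⟩ : ∃ r, L = r + 3 * l := ⟨L - 3 * l, by omega⟩
  have hr0 : 0 < r := by omega
  have hq : 2 ^ r * L ^ 3 ≤ 8 * n := by
    calc 2 ^ r * L ^ 3 ≤ 2 ^ r * (2 ^ (l + 1)) ^ 3 := by gcongr
      _ = 8 * 2 ^ (r + 3 * l) := by ring
      _ = 8 * 2 ^ L := by rw [hr]
      _ ≤ 8 * n := by gcongr
  obtain ⟨φ', D, h2', hchain, hD, hcard⟩ :=
    exists_bvaChain_card_le hr0 (c := 2 ^ r * L) (by positivity) h2 hm hV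
  refine ⟨φ', h2', hchain, ?_⟩
  have hsize := size_bound_le hL1 (hcube.trans hLn) (by omega) (by omega) Nat.one_le_two_pow hq
    rfl hD hcard
  have hr' : (1 - 3 * δ) * L ≤ (r : ℝ) := by
    have : (L : ℝ) = r + 3 * l := by exact_mod_cast hr
    linarith
  have hmain := add_one_mul_le hδ0 hδ6 (by linarith) hδL (by exact_mod_cast hL1) hεL hr'
  have hn2 : (2 : ℝ) ≤ n := by
    have : 2 ^ 1 ≤ n := (Nat.pow_le_pow_right two_pos hL1).trans hLn
    exact_mod_cast this
  have hlog0 : 0 < Real.logb 2 n := Real.logb_pos one_lt_two (by linarith)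
  have hlogle : Real.logb 2 n ≤ L + 1 := by
    rw [Real.logb_le_iff_le_rpow one_lt_two (by linarith)]
    exact_mod_cast hnL.le
  rw [le_div_iff₀ hlog0]
  calc (φ'.card : ℝ) * Real.logb 2 n ≤ φ'.card * (L + 1) :=
        mul_le_mul_of_nonneg_left hlogle (Nat.cast_nonneg _)
    _ ≤ (n : ℝ) ^ 2 * (1 / (4 * r) + 31 / (L : ℝ) ^ 2) * (L + 1) :=
        mul_le_mul_of_nonneg_right hsize (by linarith)
    _ = (n : ℝ) ^ 2 * ((L + 1) * (1 / (4 * r) + 31 / (L : ℝ) ^ 2)) := by ring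
    _ ≤ (n : ℝ) ^ 2 * (1 / 4 + ε) := mul_le_mul_of_nonneg_left hmain (sq_nonneg _)
    _ = (1 / 4 + ε) * (n : ℝ) ^ 2 := by ring

end BVAPaper
end

section
/- For every real ε > 0 there exists N such that for every n ≥ N there exists a monotone 2-CNF formula φ with exactly n variables such that every 2-CNF encoding φ' of φ satisfies |φ'| ≥ (1/4 − ε) · n² / log₂ n. -/
namespace BVAPaper

/-- The positive clause on a set of variables. -/
def edgeClause (e : Finset ℕ) : Clause := e.image (fun v => (v, true))

/-- The monotone formula whose clauses are given by a family of sets of variables. -/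
def edgeFormula (G : Finset (Finset ℕ)) : Formula := G.image edgeClause

/-- The edges joining `0` to each of `1, …, n-1`. -/
def starEdges (n : ℕ) : Finset (Finset ℕ) := (Finset.Ico 1 n).image (fun i => {0, i})

/-- Rename the variables of a formula. -/
def renameFormula (f : ℕ → ℕ) (φ : Formula) : Formula :=
  φ.image (fun C => C.image (fun l => (f l.1, l.2)))

/-- All clauses with one or two literals over the variables `0, …, k-1`. -/
def clausePool (k : ℕ) : Finset Clause :=
  ((Finset.range k ×ˢ Finset.univ) ×ˢ (Finset.range k ×ˢ Finset.univ)).image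
    (fun p : Lit × Lit => ({p.1, p.2} : Clause))

theorem card_clausePool_le (k : ℕ) : (clausePool k).card ≤ 4 * k ^ 2 := by
  refine Finset.card_image_le.trans ?_
  simp only [Finset.card_product, Finset.card_range, Finset.card_univ, Fintype.card_bool]
  exact le_of_eq (by ring)

theorem is2CNF_edgeFormula {G : Finset (Finset ℕ)} (hG : ∀ e ∈ G, e.card = 2) :
    Is2CNF (edgeFormula G) := by
  intro C hC
  obtain ⟨e, he, rfl⟩ := Finset.mem_image.1 hC
  refine ⟨fun v hv => by simp [edgeClause] at hv, ?_⟩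
  rw [edgeClause, Finset.card_image_of_injective _ (Prod.mk_left_injective true), hG e he]

theorem monotoneFormula_edgeFormula (G : Finset (Finset ℕ)) :
    MonotoneFormula (edgeFormula G) := by
  intro C hC l hl
  obtain ⟨e, he, rfl⟩ := Finset.mem_image.1 hC
  obtain ⟨v, hv, rfl⟩ := Finset.mem_image.1 hl
  rfl

theorem mem_vars {φ : Formula} {v : ℕ} : v ∈ Vars φ ↔ ∃ C ∈ φ, ∃ b, (v, b) ∈ C := by
  simp [Vars]

theorem mem_vars_edgeFormula {G : Finset (Finset ℕ)} {v : ℕ} :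
    v ∈ Vars (edgeFormula G) ↔ ∃ e ∈ G, v ∈ e := by
  simp [mem_vars, edgeFormula, edgeClause]

theorem satisfies_edgeFormula {τ : ℕ → Bool} {G : Finset (Finset ℕ)} :
    Satisfies τ (edgeFormula G) ↔ ∀ e ∈ G, ∃ v ∈ e, τ v = true := by
  simp [Satisfies, edgeFormula, edgeClause, LitTrue]

/-- The assignment that is false exactly on `e` detects whether `e` is an edge. -/
theorem satisfies_compl_iff {G : Finset (Finset ℕ)} (hG : ∀ e ∈ G, e.card = 2)
    {e : Finset ℕ} (he : e.card = 2) :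
    Satisfies (fun v => decide (v ∉ e)) (edgeFormula G) ↔ e ∉ G := by
  rw [satisfies_edgeFormula]
  constructor
  · intro h heG
    obtain ⟨v, hv, hv'⟩ := h e heG
    simp_all
  · intro h e' he'
    by_contra! hcon
    have hsub : e' ⊆ e := fun v hv => by simpa using hcon v hv
    exact h (Finset.eq_of_subset_of_card_le hsub (by rw [he, hG e' he']) ▸ he')

theorem edge_families_eq_of_encodes {G H : Finset (Finset ℕ)} (hG : ∀ e ∈ G, e.card = 2)
    (hH : ∀ e ∈ H, e.card = 2) {ψ : Formula} {X : Finset ℕ}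
    (hψG : Encodes ψ (edgeFormula G) X) (hψH : Encodes ψ (edgeFormula H) X) : G = H := by
  have key : ∀ e : Finset ℕ, e.card = 2 → (e ∈ G ↔ e ∈ H) := fun e he => by
    rw [← not_iff_not, ← satisfies_compl_iff hG he, ← satisfies_compl_iff hH he]
    exact (hψG _).trans (hψH _).symm
  ext e
  exact ⟨fun h => (key e (hG e h)).1 h, fun h => (key e (hH e h)).2 h⟩

theorem card_vars_le {φ : Formula} (hφ : Is2CNF φ) : (Vars φ).card ≤ 2 * φ.card := by
  rw [mul_comm]
  exact Finset.card_biUnion_le_card_mul _ _ _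
    fun C hC => Finset.card_image_le.trans (hφ C hC).2.le

theorem exists_renaming (n : ℕ) (A : Finset ℕ) :
    ∃ f : ℕ → ℕ, (∀ x < n, f x = x) ∧ (∀ x ∈ A, f x < n + A.card) ∧
      Set.InjOn f {x | x < n ∨ x ∈ A} := by
  have hlt : ∀ x ∈ A, ∀ y, x < y →
      (A.filter (· < x)).card < (A.filter (· < y)).card := fun x hx y hxy => by
    refine Finset.card_lt_card (Finset.ssubset_iff_subset_ne.2 ⟨fun z hz => ?_, fun h => ?_⟩)
    · simp only [Finset.mem_filter] at hz ⊢
      exact ⟨hz.1, hz.2.trans hxy⟩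
    · have : x ∈ A.filter (· < x) := h ▸ Finset.mem_filter.2 ⟨hx, hxy⟩
      simp at this
  refine ⟨fun x => if x < n then x else n + (A.filter (· < x)).card,
    fun x hx => if_pos hx, fun x hx => ?_, fun x hx y hy hxy => ?_⟩
  · have h1 := hlt x hx (x + 1) (Nat.lt_succ_self x)
    have h2 := Finset.card_filter_le A (· < x + 1)
    dsimp only
    split_ifs <;> omega
  · simp only [Set.mem_ofPred_eq] at hx hy
    dsimp only at hxy
    split_ifs at hxy with h1 h2 h2
    · exact hxy
    · omega
    · omega
    · rcases lt_trichotomy x y with h | h | h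
      · have := hlt x (hx.resolve_left h1) y h
        omega
      · exact h
      · have := hlt y (hy.resolve_left h2) x h
        omega

theorem satisfies_renameFormula {f : ℕ → ℕ} {φ : Formula} {σ : ℕ → Bool} :
    Satisfies σ (renameFormula f φ) ↔ Satisfies (σ ∘ f) φ := by
  simp [Satisfies, renameFormula, LitTrue]

theorem Satisfies.congr {φ : Formula} {σ τ : ℕ → Bool} (h : ∀ v ∈ Vars φ, σ v = τ v)
    (hσ : Satisfies σ φ) : Satisfies τ φ := fun C hC => by
  obtain ⟨l, hl, hl'⟩ := hσ C hC
  exact ⟨l, hl, (h l.1 (mem_vars.2 ⟨C, hC, l.2, hl⟩)).symm.trans hl'⟩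

theorem Encodes.renameFormula {φ' φ : Formula} {X : Finset ℕ} {f : ℕ → ℕ}
    (h : Encodes φ' φ X) (hfix : ∀ x ∈ X, f x = x)
    (hinj : Set.InjOn f {x | x ∈ X ∨ x ∈ Vars φ'}) :
    Encodes (renameFormula f φ') φ X := by
  intro τ
  rw [h τ]
  constructor
  · rintro ⟨σ, hσ, hsat⟩
    have hinv := hinj.leftInvOn_invFunOn
    refine ⟨σ ∘ Function.invFunOn f {x | x ∈ X ∨ x ∈ Vars φ'}, fun x hx => ?_,
      satisfies_renameFormula.2 (hsat.congr fun v hv => ?_)⟩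
    · have := hinv (show x ∈ {x | x ∈ X ∨ x ∈ Vars φ'} from Or.inl hx)
      rw [hfix x hx] at this
      simp only [Function.comp_apply, this, hσ x hx]
    · simp only [Function.comp_apply]
      rw [hinv (show v ∈ {x | x ∈ X ∨ x ∈ Vars φ'} from Or.inr hv)]
  · rintro ⟨σ, hσ, hsat⟩
    refine ⟨σ ∘ f, fun x hx => ?_, satisfies_renameFormula.1 hsat⟩
    simp only [Function.comp_apply, hfix x hx, hσ x hx]

/-- Every encoding with at most `m` clauses can be moved into a fixed pool of clauses. -/
theorem exists_encoding_subset_clausePool {φ φ' : Formula} {n m : ℕ} (hφ' : Is2CNF φ')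
    (henc : Encodes φ' φ (Finset.range n)) (hm : φ'.card ≤ m) :
    ∃ ψ ⊆ clausePool (n + 2 * m), ψ.card ≤ m ∧ Encodes ψ φ (Finset.range n) := by
  obtain ⟨f, hfix, hlt, hinj⟩ := exists_renaming n (Vars φ')
  refine ⟨renameFormula f φ', fun D hD => ?_, Finset.card_image_le.trans hm,
    henc.renameFormula (by simpa using hfix) (by simpa using hinj)⟩
  obtain ⟨C, hC, rfl⟩ := Finset.mem_image.1 hD
  obtain ⟨a, b, -, rfl⟩ := Finset.card_eq_two.1 (hφ' C hC).2
  have hbound : ∀ l ∈ ({a, b} : Clause), f l.1 < n + 2 * m := fun l hl => by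
    have h1 := hlt l.1 (mem_vars.2 ⟨_, hC, l.2, hl⟩)
    have h2 := card_vars_le hφ'
    omega
  refine Finset.mem_image.2 ⟨((f a.1, a.2), (f b.1, b.2)), ?_, by simp [Finset.image_insert]⟩
  simp [hbound a (by simp), hbound b (by simp)]

theorem card_small_subsets_le {α : Type*} [DecidableEq α] (U : Finset α) (m : ℕ) {x : ℝ}
    (hx : 0 < x) (hx1 : x ≤ 1) :
    ((U.powerset.filter (fun s => s.card ≤ m)).card : ℝ) * x ^ m ≤ Real.exp (x * U.card) := by
  calc ((U.powerset.filter (fun s => s.card ≤ m)).card : ℝ) * x ^ m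
      = ∑ s ∈ U.powerset.filter (fun s => s.card ≤ m), x ^ m := by simp
    _ ≤ ∑ s ∈ U.powerset.filter (fun s => s.card ≤ m), x ^ s.card :=
        Finset.sum_le_sum fun s hs =>
          pow_le_pow_of_le_one hx.le hx1 (Finset.mem_filter.1 hs).2
    _ ≤ ∑ s ∈ U.powerset, x ^ s.card :=
        Finset.sum_le_sum_of_subset_of_nonneg (Finset.filter_subset _ _)
          fun _ _ _ => by positivity
    _ = (x + 1) ^ U.card := by simp [← Finset.sum_pow_mul_eq_add_pow]
    _ ≤ Real.exp x ^ U.card := by gcongr; exact Real.add_one_le_exp x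
    _ = Real.exp (x * U.card) := by rw [← Real.exp_nat_mul, mul_comm]

theorem card_small_subsets_clausePool_le {n m : ℕ} (hn : 1 ≤ n) (hnm : n ≤ m) :
    (((clausePool (n + 2 * m)).powerset.filter (fun s => s.card ≤ m)).card : ℝ)
      ≤ (128 * m) ^ m := by
  have hm : (1 : ℝ) ≤ m := by exact_mod_cast hn.trans hnm
  have hnm' : (n : ℝ) ≤ m := by exact_mod_cast hnm
  have h := card_small_subsets_le (clausePool (n + 2 * m)) m (x := 1 / (36 * m))
    (by positivity) (by rw [div_le_one (by positivity)]; linarith)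
  have hpool : ((clausePool (n + 2 * m)).card : ℝ) ≤ 36 * m ^ 2 := by
    calc ((clausePool (n + 2 * m)).card : ℝ) ≤ 4 * (n + 2 * m) ^ 2 := by
          exact_mod_cast card_clausePool_le _
      _ ≤ 4 * (m + 2 * m) ^ 2 := by gcongr
      _ = 36 * m ^ 2 := by ring
  have hexp : Real.exp (1 / (36 * m) * (clausePool (n + 2 * m)).card) ≤ 3 ^ m := by
    calc Real.exp (1 / (36 * m) * (clausePool (n + 2 * m)).card)
        ≤ Real.exp (1 / (36 * m) * (36 * m ^ 2)) := by gcongr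
      _ = Real.exp 1 ^ m := by
          rw [← Real.exp_nat_mul]
          congr 1
          field_simp
      _ ≤ 3 ^ m := by
          gcongr
          exact Real.exp_one_lt_three.le
  have h' := h.trans hexp
  rw [one_div, inv_pow, ← div_eq_mul_inv, div_le_iff₀ (by positivity), ← mul_pow] at h'
  exact h'.trans (pow_le_pow_left₀ (by positivity) (by linarith) m)

theorem card_of_mem_starEdges {n : ℕ} {e : Finset ℕ} (he : e ∈ starEdges n) : e.card = 2 := by
  obtain ⟨i, hi, rfl⟩ := Finset.mem_image.1 he
  exact Finset.card_pair (by simp at hi; omega)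

theorem zero_mem_of_mem_starEdges {n : ℕ} {e : Finset ℕ} (he : e ∈ starEdges n) : 0 ∈ e := by
  obtain ⟨i, hi, rfl⟩ := Finset.mem_image.1 he
  simp

theorem vars_star_union {n : ℕ} (hn : 2 ≤ n) {S : Finset (Finset ℕ)}
    (hS : S ⊆ (Finset.Ico 1 n).powersetCard 2) :
    Vars (edgeFormula (starEdges n ∪ S)) = Finset.range n := by
  ext v
  rw [mem_vars_edgeFormula, Finset.mem_range]
  constructor
  · rintro ⟨e, he, hv⟩
    rcases Finset.mem_union.1 he with he | he
    · obtain ⟨i, hi, rfl⟩ := Finset.mem_image.1 he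
      simp at hi hv
      omega
    · have := (Finset.mem_powersetCard.1 (hS he)).1 hv
      simp at this
      omega
  · intro hv
    rcases Nat.eq_zero_or_pos v with rfl | h0
    · exact ⟨{0, 1}, Finset.mem_union_left _
        (Finset.mem_image.2 ⟨1, by simp; omega, rfl⟩), by simp⟩
    · exact ⟨{0, v}, Finset.mem_union_left _
        (Finset.mem_image.2 ⟨v, by simp; omega, rfl⟩), by simp⟩

/-- If there are too few formulas with `m` clauses, then some monotone 2-CNF formula with `n`
variables has no 2-CNF encoding with at most `m` clauses. -/
theorem exists_hard_monotone {n m : ℕ} (hn : 2 ≤ n) (hnm : n ≤ m)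
    (hlt : (128 * m : ℝ) ^ m < 2 ^ (n - 1).choose 2) :
    ∃ φ : Formula, Is2CNF φ ∧ MonotoneFormula φ ∧ (Vars φ).card = n ∧
      ∀ φ' : Formula, Is2CNF φ' → Encodes φ' φ (Vars φ) → m < φ'.card := by
  by_contra! hcon
  set T := (Finset.Ico 1 n).powersetCard 2 with hT
  have hcard : ∀ S ∈ T.powerset, ∀ e ∈ starEdges n ∪ S, e.card = 2 := fun S hS e he => by
    rcases Finset.mem_union.1 he with he | he
    · exact card_of_mem_starEdges he
    · exact (Finset.mem_powersetCard.1 (Finset.mem_powerset.1 hS he)).2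
  have hex : ∀ S ∈ T.powerset, ∃ ψ ⊆ clausePool (n + 2 * m), ψ.card ≤ m ∧
      Encodes ψ (edgeFormula (starEdges n ∪ S)) (Finset.range n) := fun S hS => by
    have hv := vars_star_union hn (Finset.mem_powerset.1 hS)
    obtain ⟨φ', h2, henc, hle⟩ := hcon _ (is2CNF_edgeFormula (hcard S hS))
      (monotoneFormula_edgeFormula _) (by rw [hv, Finset.card_range])
    exact exists_encoding_subset_clausePool h2 (hv ▸ henc) hle
  choose! g hgU hgm hgenc using hex
  have hle : T.powerset.card ≤
      ((clausePool (n + 2 * m)).powerset.filter (fun s => s.card ≤ m)).card := by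
    refine Finset.card_le_card_of_injOn g (fun S hS => ?_) fun S hS S' hS' hSS' => ?_
    · simp only [Finset.coe_filter, Finset.mem_powerset, Set.mem_ofPred_eq]
      exact ⟨hgU S hS, hgm S hS⟩
    · have heq := edge_families_eq_of_encodes (hcard S hS) (hcard S' hS')
        (hgenc S hS) (hSS' ▸ hgenc S' hS')
      have hdisj : ∀ R ∈ T.powerset, Disjoint (starEdges n) R := fun R hR =>
        Finset.disjoint_left.2 fun e he heR => by
          have := (Finset.mem_powersetCard.1 (Finset.mem_powerset.1 hR heR)).1
            (zero_mem_of_mem_starEdges he)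
          simp at this
      rw [← Finset.union_sdiff_cancel_left (hdisj S hS), heq,
        Finset.union_sdiff_cancel_left (hdisj S' hS')]
  rw [Finset.card_powerset, hT, Finset.card_powersetCard, Nat.card_Ico] at hle
  have := card_small_subsets_clausePool_le (by omega : 1 ≤ n) hnm
  have hle' : (2 : ℝ) ^ (n - 1).choose 2 ≤
      ((clausePool (n + 2 * m)).powerset.filter (fun s => s.card ≤ m)).card := by
    exact_mod_cast hle
  linarith

/-- For `c < 1/4`, there are fewer formulas with `c n² / log₂ n` clauses than graphs. -/
theorem eventually_count_lt {c : ℝ} (hc0 : 0 < c) (hc : c < 1 / 4) :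
    ∀ᶠ n : ℕ in Filter.atTop,
      n ≤ ⌊c * (n : ℝ) ^ 2 / Real.logb 2 n⌋₊ ∧
      (128 * (⌊c * (n : ℝ) ^ 2 / Real.logb 2 n⌋₊ : ℝ)) ^ ⌊c * (n : ℝ) ^ 2 / Real.logb 2 n⌋₊
        < 2 ^ (n - 1).choose 2 := by
  have hcast := tendsto_natCast_atTop_atTop (R := ℝ)
  have hL : Filter.Tendsto (fun n : ℕ => Real.logb 2 (n : ℝ)) Filter.atTop Filter.atTop :=
    (Real.tendsto_logb_atTop (by norm_num)).comp hcast
  have hlog : ∀ᶠ n : ℕ in Filter.atTop, Real.log (n : ℝ) ≤ c * Real.log 2 * n := by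
    have hpos : 0 < c * Real.log 2 := mul_pos hc0 (Real.log_pos (by norm_num))
    have := (Real.isLittleO_log_id_atTop.comp_tendsto hcast).bound hpos
    filter_upwards [this] with n hn
    simp only [Function.comp_apply, id_eq, Real.norm_eq_abs, Nat.abs_cast] at hn
    exact (le_abs_self _).trans hn
  have hδ : 0 < 1 / 2 - 2 * c := by linarith
  filter_upwards [hlog, Filter.eventually_ge_atTop 2, hL.eventually_ge_atTop 1,
    hL.eventually_gt_atTop (14 * c / (1 / 2 - 2 * c)),
    hcast.eventually_gt_atTop (3 / (1 / 2 - 2 * c))] with n hlogn hn2 hL1 hLbig hnbig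
  set L := Real.logb 2 (n : ℝ) with hLdef
  have hL0 : 0 < L := by linarith
  have hn0 : (0 : ℝ) < n := by positivity
  have hLn : L ≤ c * n := by
    rw [hLdef, Real.logb, div_le_iff₀ (Real.log_pos (by norm_num))]
    linarith
  set m := ⌊c * (n : ℝ) ^ 2 / L⌋₊
  have hmle : (m : ℝ) ≤ c * n ^ 2 / L := Nat.floor_le (by positivity)
  have hmn : n ≤ m := by
    refine Nat.le_floor ?_
    rw [le_div_iff₀ hL0]
    nlinarith
  refine ⟨hmn, ?_⟩
  have hmsq : (m : ℝ) ≤ n ^ 2 := by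
    refine hmle.trans ?_
    rw [div_le_iff₀ hL0]
    nlinarith [sq_nonneg (n : ℝ)]
  have hbase : (128 * m : ℝ) ≤ 2 ^ (7 + 2 * L) := by
    rw [Real.rpow_add (by norm_num), mul_comm (2 : ℝ) L, Real.rpow_mul (by norm_num),
      Real.rpow_logb (by norm_num) (by norm_num) hn0]
    norm_num
    exact hmsq
  have hchoose : (((n - 1).choose 2 : ℕ) : ℝ) = (n - 1) * (n - 2) / 2 := by
    rw [Nat.cast_choose_two, Nat.cast_sub (by omega)]
    push_cast
    ring
  calc (128 * m : ℝ) ^ m ≤ ((2 : ℝ) ^ (7 + 2 * L)) ^ m := by gcongr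
    _ = (2 : ℝ) ^ ((7 + 2 * L) * m) := by rw [Real.rpow_mul (by norm_num), Real.rpow_natCast]
    _ < (2 : ℝ) ^ (((n - 1).choose 2 : ℕ) : ℝ) := by
        refine Real.rpow_lt_rpow_of_exponent_lt (by norm_num) ?_
        rw [hchoose]
        rw [div_lt_iff₀ hδ] at hLbig hnbig
        have h1 : (7 + 2 * L) * m ≤ (7 + 2 * L) * (c * n ^ 2 / L) := by gcongr
        have h2 : (7 + 2 * L) * (c * n ^ 2 / L) = 7 * c / L * n ^ 2 + 2 * c * n ^ 2 := by
          field_simp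
        have h3 : 7 * c / L * (n : ℝ) ^ 2 ≤ (1 / 2 - 2 * c) / 2 * n ^ 2 := by
          refine mul_le_mul_of_nonneg_right ?_ (sq_nonneg _)
          rw [div_le_iff₀ hL0]
          linarith
        nlinarith
    _ = 2 ^ (n - 1).choose 2 := Real.rpow_natCast _ _

/-- lower bound for 2-CNF encodings of monotone 2-CNF formulas. -/
theorem monotone_encoding_lower (ε : ℝ) (hε : 0 < ε) :
    ∃ N : ℕ, ∀ n : ℕ, N ≤ n →
      ∃ φ : Formula, Is2CNF φ ∧ MonotoneFormula φ ∧ (Vars φ).card = n ∧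
        ∀ φ' : Formula, Is2CNF φ' → Encodes φ' φ (Vars φ) →
          (1 / 4 - ε) * (n : ℝ) ^ 2 / Real.logb 2 (n : ℝ) ≤ (φ'.card : ℝ) := by
  set c := max (1 / 4 - ε) (1 / 8)
  have hc0 : 0 < c := lt_max_of_lt_right (by norm_num)
  have hc : c < 1 / 4 := max_lt (by linarith) (by norm_num)
  obtain ⟨N, hN⟩ := Filter.eventually_atTop.1 (eventually_count_lt hc0 hc)
  refine ⟨max N 2, fun n hn => ?_⟩
  have hn2 : 2 ≤ n := (le_max_right _ _).trans hn
  obtain ⟨hnm, hlt⟩ := hN n ((le_max_left _ _).trans hn)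
  obtain ⟨φ, h2, hmono, hvars, hhard⟩ := exists_hard_monotone hn2 hnm hlt
  refine ⟨φ, h2, hmono, hvars, fun φ' hφ' henc => ?_⟩
  have hL : 0 ≤ Real.logb 2 (n : ℝ) :=
    Real.logb_nonneg (by norm_num) (by exact_mod_cast (by omega : 1 ≤ n))
  calc (1 / 4 - ε) * (n : ℝ) ^ 2 / Real.logb 2 (n : ℝ)
      ≤ c * (n : ℝ) ^ 2 / Real.logb 2 (n : ℝ) := by
        gcongr
        exact le_max_left _ _
    _ ≤ (φ'.card : ℝ) := ((Nat.floor_lt' (by have := hhard φ' hφ' henc; omega)).1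
        (hhard φ' hφ' henc)).le

end BVAPaper
end
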